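/- arXiv:1305.1984 — 6 statements merged into one kernel-verified Lean document; each statement's English description precedes it below -/
import Mathlib

section
/- For all integers n, m, ℓ with 1 ≤ m ≤ n and ℓ ≥ m, the cardinality of 𝒳_m^{(ℓ)} equals m!·C(n,m)·S(ℓ−1, m−1), where C(n,m) is the binomial coefficient. -/
/-- `stirling2 a b` is the Stirling number of the second kind: the number of
partitions of an `a`-element set into `b` nonempty blocks. -/
def stirling2 : ℕ → ℕ → ℕ
  | 0, 0 => 1
  | 0, _ + 1 => 0
  | _ + 1, 0 => 0
  | a + 1, b + 1 => (b + 1) * stirling2 a (b + 1) + stirling2 a b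

/-- `pathSet n m ℓ` is the set `𝒳_m^{(ℓ)}` of sequences `(χ_1, …, χ_ℓ)` of length `ℓ`
with entries in an `n`-element set such that the set of entries has exactly `m` elements
and the last entry is distinct from all previous entries. -/
def pathSet (n m ℓ : ℕ) : Finset (Fin ℓ → Fin n) :=
  Finset.univ.filter (fun χ =>
    (Finset.image χ Finset.univ).card = m ∧
    ∀ t s : Fin ℓ, (t : ℕ) < ℓ - 1 → (s : ℕ) = ℓ - 1 → χ t ≠ χ s)

theorem aux_split (n ℓ : ℕ) (P : (Fin (ℓ+1) → Fin n) → Prop) [DecidablePred P] :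
    (Finset.univ.filter P).card =
      ∑ f : Fin ℓ → Fin n,
        (Finset.univ.filter (fun x : Fin n => P (Fin.snoc (α := fun _ => Fin n) f x))).card := by
  simp only [Finset.card_filter]
  rw [← (Fin.snocEquiv (fun _ : Fin (ℓ+1) => Fin n)).sum_comp, Fintype.sum_prod_type_right]
  rfl

theorem aux_image (n ℓ : ℕ) (f : Fin ℓ → Fin n) (x : Fin n) :
    Finset.image (Fin.snoc (α := fun _ => Fin n) f x : Fin (ℓ+1) → Fin n) Finset.univ
      = insert x (Finset.image f Finset.univ) := by
  ext y
  simp only [Finset.mem_image, Finset.mem_univ, true_and, Finset.mem_insert, Fin.exists_fin_succ',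
    Fin.snoc_castSucc, Fin.snoc_last]
  tauto

theorem aux_new (n m : ℕ) (s : Finset (Fin n)) :
    (Finset.univ.filter (fun x => x ∉ s ∧ s.card = m)).card
      = (n - m) * (if s.card = m then 1 else 0) := by
  split_ifs with h
  · have : (Finset.univ.filter (fun x => x ∉ s ∧ s.card = m)) = sᶜ := by
      ext x; simp [h]
    rw [this, Finset.card_compl, Fintype.card_fin, h, mul_one]
  · simp [h]

theorem aux_old (n m : ℕ) (s : Finset (Fin n)) :
    (Finset.univ.filter (fun x => x ∈ s ∧ s.card = m)).card
      = m * (if s.card = m then 1 else 0) := by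
  split_ifs with h
  · have : (Finset.univ.filter (fun x => x ∈ s ∧ s.card = m)) = s := by
      ext x; simp [h]
    rw [this, h, mul_one]
  · simp [h]

theorem aux_count (n ℓ : ℕ) : ∀ m : ℕ,
    (Finset.univ.filter (fun f : Fin ℓ → Fin n => (Finset.image f Finset.univ).card = m)).card
      = n.descFactorial m * stirling2 ℓ m := by
  induction ℓ with
  | zero =>
    intro m
    cases m with
    | zero => simp [stirling2]
    | succ m => simp [stirling2]
  | succ ℓ ih =>
    intro m
    rw [aux_split]
    simp only [aux_image]
    cases m with
    | zero => simp [stirling2]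
    | succ m =>
      have key : ∀ f : Fin ℓ → Fin n,
          (Finset.univ.filter (fun x : Fin n =>
            (insert x (Finset.image f Finset.univ)).card = m + 1)).card
          = (m + 1) * (if (Finset.image f Finset.univ).card = m + 1 then 1 else 0)
            + (n - m) * (if (Finset.image f Finset.univ).card = m then 1 else 0) := by
        intro f
        rw [← aux_new, ← aux_old, ← Finset.card_union_of_disjoint]
        · congr 1
          ext x
          by_cases hx : x ∈ Finset.image f Finset.univ
          · simp only [Finset.mem_filter, Finset.mem_union, Finset.mem_univ, true_and,
              Finset.insert_eq_of_mem hx, hx]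
            tauto
          · simp only [Finset.mem_filter, Finset.mem_union, Finset.mem_univ, true_and,
              Finset.card_insert_of_notMem hx, hx]
            simp
        · rw [Finset.disjoint_left]
          intro x h1 h2
          simp only [Finset.mem_filter] at h1 h2
          exact h2.2.1 h1.2.1
      simp only [key]
      rw [Finset.sum_add_distrib, ← Finset.mul_sum, ← Finset.mul_sum, ← Finset.card_filter,
        ← Finset.card_filter, ih, ih, stirling2, Nat.descFactorial_succ]
      ring

theorem card_pathSet (n m ℓ : ℕ) (hm : 1 ≤ m) (hmn : m ≤ n) (hℓ : m ≤ ℓ) :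
    (pathSet n m ℓ).card = m.factorial * n.choose m * stirling2 (ℓ - 1) (m - 1) := by
  obtain ⟨m, rfl⟩ : ∃ k, m = k + 1 := ⟨m - 1, by omega⟩
  obtain ⟨ℓ, rfl⟩ : ∃ k, ℓ = k + 1 := ⟨ℓ - 1, by omega⟩
  rw [← Nat.descFactorial_eq_factorial_mul_choose, pathSet, aux_split]
  have key : ∀ f : Fin ℓ → Fin n,
      (Finset.univ.filter (fun x : Fin n =>
        (Finset.image (Fin.snoc (α := fun _ => Fin n) f x : Fin (ℓ+1) → Fin n)
          Finset.univ).card = m + 1 ∧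
        ∀ t s : Fin (ℓ+1), (t : ℕ) < ℓ + 1 - 1 → (s : ℕ) = ℓ + 1 - 1 →
          (Fin.snoc (α := fun _ => Fin n) f x : Fin (ℓ+1) → Fin n) t ≠
          (Fin.snoc (α := fun _ => Fin n) f x : Fin (ℓ+1) → Fin n) s)).card
      = (n - m) * (if (Finset.image f Finset.univ).card = m then 1 else 0) := by
    intro f
    rw [← aux_new]
    congr 1
    ext x
    simp only [Finset.mem_filter, Finset.mem_univ, true_and, aux_image]
    have h : (∀ t s : Fin (ℓ+1), (t : ℕ) < ℓ + 1 - 1 → (s : ℕ) = ℓ + 1 - 1 →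
          (Fin.snoc (α := fun _ => Fin n) f x : Fin (ℓ+1) → Fin n) t ≠
          (Fin.snoc (α := fun _ => Fin n) f x : Fin (ℓ+1) → Fin n) s) ↔
        x ∉ Finset.image f Finset.univ := by
      constructor
      · intro H hx
        obtain ⟨t, -, ht⟩ := Finset.mem_image.1 hx
        refine H t.castSucc (Fin.last ℓ) (by simp) (by simp) ?_
        rw [Fin.snoc_castSucc, Fin.snoc_last, ht]
      · intro hx t s ht hs
        obtain rfl : s = Fin.last ℓ := Fin.ext (by simpa using hs)
        obtain ⟨t', rfl⟩ : ∃ t' : Fin ℓ, t = t'.castSucc :=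
          ⟨⟨t, by omega⟩, rfl⟩
        rw [Fin.snoc_castSucc, Fin.snoc_last]
        intro h
        exact hx (Finset.mem_image.2 ⟨t', Finset.mem_univ _, h⟩)
    rw [h]
    constructor
    · rintro ⟨h1, h2⟩
      rw [Finset.card_insert_of_notMem h2] at h1
      exact ⟨h2, by omega⟩
    · rintro ⟨h2, h1⟩
      rw [Finset.card_insert_of_notMem h2]
      exact ⟨by omega, h2⟩
  rw [Finset.sum_congr rfl (fun f _ => key f), ← Finset.mul_sum, ← Finset.card_filter, aux_count,
    Nat.descFactorial_succ]
  simp only [Nat.add_sub_cancel]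
  ring
end

section
/- For all integers n, m with 1 ≤ m ≤ n, the series Σ_{ℓ=m}^∞ S(ℓ−1, m−1)·n^{−ℓ} converges and equals (n−m)!/n!. -/
theorem stirling2_zero_of_lt : ∀ (a k : ℕ), a < k → stirling2 a k = 0
  | 0, 0, h => absurd h (lt_irrefl _)
  | 0, _ + 1, _ => by rw [stirling2]
  | _ + 1, 0, h => by omega
  | a + 1, k + 1, h => by
    rw [stirling2, stirling2_zero_of_lt a (k + 1) (by omega), stirling2_zero_of_lt a k (by omega)]
    simp

theorem stirling2_gf (N k : ℕ) (hk : k ≤ N) :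
    HasSum (fun a : ℕ => (stirling2 a k : ℝ) / ((N : ℝ) + 1) ^ a)
      ((N - k).factorial / N.factorial) := by
  have hN : (0 : ℝ) < (N : ℝ) + 1 := by positivity
  induction k with
  | zero =>
    have h := hasSum_single (f := fun a : ℕ => (stirling2 a 0 : ℝ) / ((N : ℝ) + 1) ^ a) 0 (by
      intro a ha
      obtain ⟨b, rfl⟩ := Nat.exists_eq_succ_of_ne_zero ha
      simp [stirling2])
    have hf : (N.factorial : ℝ) ≠ 0 := by positivity
    simpa [stirling2, hf] using h
  | succ k ih =>
    have ih := ih (by omega)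
    set G : ℝ := ((N - k).factorial / N.factorial : ℝ) with hG
    set f : ℕ → ℝ := fun a : ℕ => (stirling2 a (k + 1) : ℝ) / ((N : ℝ) + 1) ^ a with hf
    set g : ℕ → ℝ := fun a : ℕ => (stirling2 a k : ℝ) / ((N : ℝ) + 1) ^ a with hg
    have hf0 : f 0 = 0 := by simp [hf, stirling2]
    have hfnn : ∀ a, 0 ≤ f a := fun a => by simp only [hf]; positivity
    have hgnn : ∀ a, 0 ≤ g a := fun a => by simp only [hg]; positivity
    have hrec : ∀ a, f (a + 1) = ((k + 1) * f a + g a) / (N + 1) := by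
      intro a
      simp only [hf, hg, stirling2]
      push_cast
      field_simp
      ring
    have hkN : (k : ℝ) + 1 ≤ N := by exact_mod_cast hk
    have hpos : (0 : ℝ) < N - k := by linarith
    have hsum : Summable f := by
      refine summable_of_sum_range_le (c := G / (N - k)) hfnn ?_
      intro M
      have h1 : ∑ i ∈ Finset.range M, f i ≤ ∑ i ∈ Finset.range (M + 1), f i :=
        Finset.sum_le_sum_of_subset_of_nonneg (by simp) (fun i _ _ => hfnn i)
      rw [Finset.sum_range_succ', hf0, add_zero] at h1
      simp_rw [hrec] at h1
      rw [← Finset.sum_div, Finset.sum_add_distrib, ← Finset.mul_sum, le_div_iff₀ hN] at h1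
      have h2 : ∑ i ∈ Finset.range M, g i ≤ G := sum_le_hasSum _ (fun i _ => hgnn i) ih
      rw [le_div_iff₀ hpos]
      linarith
    have h3 : HasSum (fun a => f (a + 1)) (((k + 1) * (∑' a, f a) + G) / (N + 1)) := by
      simp_rw [hrec]
      exact ((hsum.hasSum.mul_left _).add ih).div_const _
    have h4 := hsum.hasSum
    rw [← hasSum_nat_add_iff' 1] at h4
    simp only [Finset.range_one, Finset.sum_singleton, hf0, sub_zero] at h4
    have h5 := h4.unique h3
    have h6 : (∑' a, f a) = (N - (k + 1)).factorial / N.factorial := by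
      obtain ⟨d, rfl⟩ := Nat.exists_eq_add_of_le hk
      have e1 : k + 1 + d - k = d + 1 := by omega
      have e2 : k + 1 + d - (k + 1) = d := by omega
      rw [e1, Nat.factorial_succ] at hG
      rw [e2]
      rw [eq_div_iff hN.ne'] at h5
      push_cast at h5 hG
      have h7 : (∑' a, f a) * (d + 1) = ((d : ℝ) + 1) * d.factorial / (k + 1 + d).factorial := by
        rw [← hG]; linarith
      have hd : (d : ℝ) + 1 ≠ 0 := by positivity
      apply mul_right_cancel₀ hd
      rw [h7]; ring
    rw [← h6]
    exact hsum.hasSum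

/-- The series `Σ_{ℓ=m}^∞ S(ℓ−1, m−1) · n^{−ℓ}` converges and equals `(n−m)!/n!`. -/
theorem stirling_series (n m : ℕ) (hm : 1 ≤ m) (hmn : m ≤ n) :
    HasSum (fun ℓ : ℕ => if m ≤ ℓ then (stirling2 (ℓ - 1) (m - 1) : ℝ) / n ^ ℓ else 0)
      ((n - m).factorial / n.factorial) := by
  obtain ⟨k, rfl⟩ := Nat.exists_eq_add_of_le' hm
  obtain ⟨N, rfl⟩ := Nat.exists_eq_add_of_le' (hm.trans hmn)
  rw [← hasSum_nat_add_iff' 1]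
  have h := (stirling2_gf N k (by omega)).div_const ((N : ℝ) + 1)
  have hN : (N : ℝ) + 1 ≠ 0 := by positivity
  convert h using 1
  · rfl
  · funext a
    by_cases hka : k ≤ a
    · simp [hka, pow_succ, div_div]
    · simp [hka, stirling2_zero_of_lt a k (by omega)]
  · simp [Nat.factorial_succ]
    field_simp
end

section
/- For all integers n, m with 1 ≤ m ≤ n, E_m[1/ℓ] = (n!/(n−m)!)·∫_0^{1/n} x^{m−1}/((1−x)(1−2x)⋯(1−(m−1)x)) dx, where the integrand's denominator is the product Π_{k=1}^{m−1}(1−kx) (equal to 1 when m = 1). -/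
/-- `E_m[1/ℓ] := m!·C(n,m)·Σ_{ℓ=m}^∞ S(ℓ−1, m−1)/(ℓ·n^ℓ)`, the expected reciprocal of
the waiting time until `m` distinct values have appeared in i.i.d. uniform draws from an
`n`-element set. -/
noncomputable def Erecip (n m : ℕ) : ℝ :=
  (m.factorial * n.choose m : ℝ) *
    ∑' ℓ : ℕ, if m ≤ ℓ then (stirling2 (ℓ - 1) (m - 1) : ℝ) / (ℓ * n ^ ℓ) else 0

theorem stirling2_lt : ∀ a b : ℕ, a < b → stirling2 a b = 0
  | 0, 0, h => by omega
  | 0, _ + 1, _ => by simp [stirling2]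
  | _ + 1, 0, h => by omega
  | a + 1, b + 1, h => by
    simp [stirling2, stirling2_lt a (b + 1) (by omega), stirling2_lt a b (by omega)]

theorem stirling2_hasSum (b : ℕ) (x : ℝ) (hx : 0 ≤ x) (hb : (b : ℝ) * x < 1) :
    HasSum (fun a => (stirling2 a b : ℝ) * x ^ a)
      (x ^ b / ∏ k ∈ Finset.Icc 1 b, (1 - (k : ℝ) * x)) := by
  induction b with
  | zero =>
    have := hasSum_single (f := fun a => (stirling2 a 0 : ℝ) * x ^ a) 0 (by
      intro a ha
      cases a with
      | zero => exact absurd rfl ha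
      | succ a => simp [stirling2])
    simpa [stirling2] using this
  | succ b ih =>
    push_cast at hb
    have ih := ih (by nlinarith)
    set F := x ^ b / ∏ k ∈ Finset.Icc 1 b, (1 - (k : ℝ) * x) with hF
    have hrec : ∀ a, (stirling2 (a + 1) (b + 1) : ℝ) * x ^ (a + 1)
        = ((b + 1) * x) * ((stirling2 a (b + 1) : ℝ) * x ^ a)
          + x * ((stirling2 a b : ℝ) * x ^ a) := by
      intro a
      simp only [stirling2]
      push_cast
      ring
    have h0 : (stirling2 0 (b + 1) : ℝ) * x ^ 0 = 0 := by simp [stirling2]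
    have hpos : (0 : ℝ) < 1 - (b + 1) * x := by linarith
    have hs : Summable (fun a => (stirling2 a (b + 1) : ℝ) * x ^ a) := by
      apply summable_of_sum_range_le (c := x * F / (1 - (b + 1) * x))
      · intro a; positivity
      · intro N
        rw [le_div_iff₀ hpos]
        have h1 := Finset.sum_range_succ (fun a => (stirling2 a (b + 1) : ℝ) * x ^ a) N
        have h2 := Finset.sum_range_succ' (fun a => (stirling2 a (b + 1) : ℝ) * x ^ a) N
        simp only [hrec, h0, Finset.sum_add_distrib, ← Finset.mul_sum] at h2
        have h3 : ∑ a ∈ Finset.range N, (stirling2 a b : ℝ) * x ^ a ≤ F :=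
          sum_le_hasSum _ (fun a _ => by positivity) ih
        have h4 : (0 : ℝ) ≤ (stirling2 N (b + 1) : ℝ) * x ^ N := by positivity
        have h5 := mul_le_mul_of_nonneg_left h3 hx
        linarith
    obtain ⟨T, hT⟩ := hs
    have hT' := (hasSum_nat_add_iff' 1).2 hT
    simp only [hrec, Finset.sum_range_one, h0, sub_zero] at hT'
    have hE := hT'.unique ((hT.mul_left ((b + 1) * x)).add (ih.mul_left x))
    convert hT using 1
    rw [Finset.prod_Icc_succ_top (by omega)]
    push_cast
    rw [pow_succ, mul_div_mul_comm, ← hF, ← mul_div_assoc, div_eq_iff hpos.ne']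
    linarith

/-- `E_m[1/ℓ] = (n!/(n−m)!)·∫_0^{1/n} x^{m−1}/((1−x)(1−2x)⋯(1−(m−1)x)) dx`. -/
theorem Erecip_eq_integral (n m : ℕ) (hm : 1 ≤ m) (hmn : m ≤ n) :
    Erecip n m = ((n.factorial : ℝ) / (n - m).factorial) *
      ∫ x in (0 : ℝ)..(1 / n), x ^ (m - 1) / ∏ k ∈ Finset.Icc 1 (m - 1), (1 - (k : ℝ) * x) := by
  have hn : (0 : ℝ) < n := by exact_mod_cast (by omega : 0 < n)
  have hn1 : (0 : ℝ) ≤ 1 / n := by positivity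
  obtain ⟨b, rfl⟩ : ∃ b, m = b + 1 := ⟨m - 1, by omega⟩
  have hbn : (b : ℝ) + 1 ≤ n := by exact_mod_cast hmn
  have hb1 : (b : ℝ) * (1 / n) < 1 := by
    rw [mul_one_div, div_lt_one hn]; linarith
  simp only [Nat.add_sub_cancel]
  have key := intervalIntegral.hasSum_integral_of_dominated_convergence
    (μ := MeasureTheory.volume) (a := (0 : ℝ)) (b := 1 / (n : ℝ))
    (F := fun a (x : ℝ) => (stirling2 a b : ℝ) * x ^ a)
    (f := fun x : ℝ => x ^ b / ∏ k ∈ Finset.Icc 1 b, (1 - (k : ℝ) * x))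
    (fun a _ => (stirling2 a b : ℝ) * (1 / (n : ℝ)) ^ a)
    (fun a => (by fun_prop : Continuous fun x : ℝ => (stirling2 a b : ℝ) * x ^ a).aestronglyMeasurable)
    (fun a => Filter.Eventually.of_forall fun x hx => by
      rw [Set.uIoc_of_le hn1] at hx
      have := hx.1.le
      rw [Real.norm_of_nonneg (by positivity)]
      have := hx.2
      gcongr)
    (Filter.Eventually.of_forall fun x _ => (stirling2_hasSum b _ hn1 hb1).summable)
    (by simp)
    (Filter.Eventually.of_forall fun x hx => by
      rw [Set.uIoc_of_le hn1] at hx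
      refine stirling2_hasSum b x hx.1.le (lt_of_le_of_lt ?_ hb1)
      exact mul_le_mul_of_nonneg_left hx.2 (by positivity))
  have hsum : HasSum (fun ℓ : ℕ => if b + 1 ≤ ℓ then
      (stirling2 (ℓ - 1) b : ℝ) / (ℓ * n ^ ℓ) else 0)
      (∫ x in (0 : ℝ)..(1 / n), x ^ b / ∏ k ∈ Finset.Icc 1 b, (1 - (k : ℝ) * x)) := by
    rw [← hasSum_nat_add_iff' 1]
    simp only [Finset.sum_range_one, Nat.add_sub_cancel]
    rw [if_neg (by omega), sub_zero]
    convert key using 1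
    funext a
    rw [intervalIntegral.integral_const_mul, integral_pow]
    split_ifs with h
    · push_cast
      rw [one_div, inv_pow, zero_pow (by omega), sub_zero]
      field_simp
    · rw [stirling2_lt a b (by omega)]; simp
  unfold Erecip
  simp only [Nat.add_sub_cancel]
  rw [hsum.tsum_eq]
  congr 1
  rw [eq_div_iff (by positivity)]
  have := Nat.choose_mul_factorial_mul_factorial hmn
  rw [← this]
  push_cast
  ring
end

section
/- For all integers n, m with 1 < m ≤ n, one has E_m[1/ℓ] ≤ 1/E_{m−1}[ℓ] + (m−1)(n−m)/(2n²), where E_{m−1}[ℓ] = Σ_{j=0}^{m−2} n/(n−j). -/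
/-- `E_m[ℓ] := Σ_{j=0}^{m−1} n/(n−j)`, the expected waiting time until `m` distinct values
have appeared in i.i.d. uniform draws from an `n`-element set. -/
noncomputable def Ewait (n m : ℕ) : ℝ :=
  ∑ j ∈ Finset.range m, (n : ℝ) / ((n : ℝ) - j)

lemma stir_bound (u : ℝ) (b : ℕ) : (b : ℝ) < u → ∀ N : ℕ,
    ∑ a ∈ Finset.range N, (stirling2 a b : ℝ) / u ^ a ≤
      ∏ j ∈ Finset.range b, 1 / (u - ((j : ℝ) + 1)) := by
  induction b with
  | zero =>
    intro hu N
    cases N with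
    | zero => simp
    | succ N =>
      rw [Finset.sum_range_succ']
      simp [stirling2]
  | succ b ih =>
    intro hu N
    push_cast at hu
    have hb0 : (0 : ℝ) ≤ b := Nat.cast_nonneg b
    have hu0 : 0 < u := by linarith
    have hnn : 0 ≤ ∏ j ∈ Finset.range (b + 1), 1 / (u - ((j : ℝ) + 1)) := by
      apply Finset.prod_nonneg
      intro j hj
      have : (j : ℝ) ≤ b := by
        have := Finset.mem_range.1 hj
        exact_mod_cast Nat.lt_succ_iff.1 this
      apply div_nonneg zero_le_one
      linarith
    cases N with
    | zero => simpa using hnn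
    | succ N =>
      have h1 := ih (by linarith) N
      rw [Finset.prod_range_succ, mul_one_div, le_div_iff₀ (by linarith)]
      refine le_trans ?_ h1
      have hrec : ∑ a ∈ Finset.range (N + 1), (stirling2 a (b + 1) : ℝ) / u ^ a =
          (((b : ℝ) + 1) * ∑ a ∈ Finset.range N, (stirling2 a (b + 1) : ℝ) / u ^ a +
            ∑ a ∈ Finset.range N, (stirling2 a b : ℝ) / u ^ a) / u := by
        rw [Finset.sum_range_succ']
        simp only [stirling2]
        rw [Finset.mul_sum, ← Finset.sum_add_distrib, Finset.sum_div]
        simp only [Nat.cast_zero, zero_div, add_zero]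
        apply Finset.sum_congr rfl
        intro a _
        push_cast
        field_simp
        ring
      have hmono : ∑ a ∈ Finset.range N, (stirling2 a (b + 1) : ℝ) / u ^ a ≤
          ∑ a ∈ Finset.range (N + 1), (stirling2 a (b + 1) : ℝ) / u ^ a := by
        rw [Finset.sum_range_succ]
        have : 0 ≤ (stirling2 N (b + 1) : ℝ) / u ^ N := by positivity
        linarith
      set X := ∑ a ∈ Finset.range (N + 1), (stirling2 a (b + 1) : ℝ) / u ^ a
      rw [eq_div_iff hu0.ne'] at hrec
      nlinarith

noncomputable def qq (n m : ℕ) (ℓ : ℕ) : ℝ :=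
  (m.factorial * n.choose m : ℝ) * (if m ≤ ℓ then (stirling2 (ℓ - 1) (m - 1) : ℝ) else 0)

lemma qq_nonneg (n m ℓ : ℕ) : 0 ≤ qq n m ℓ := by
  unfold qq
  split_ifs <;> positivity

lemma qq_zero (n m ℓ : ℕ) (h : ℓ < m) : qq n m ℓ = 0 := by
  unfold qq
  rw [if_neg (by omega), mul_zero]

lemma desc_real (n m : ℕ) (h : m ≤ n) :
    (m.factorial * n.choose m : ℝ) = ∏ j ∈ Finset.range m, ((n : ℝ) - j) := by
  have := Nat.descFactorial_eq_factorial_mul_choose n m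
  rw [Nat.descFactorial_eq_prod_range] at this
  have h2 : ((∏ i ∈ Finset.range m, (n - i) : ℕ) : ℝ) = (m.factorial * n.choose m : ℝ) := by
    rw [this]; push_cast; ring
  rw [← h2]
  push_cast
  apply Finset.prod_congr rfl
  intro j hj
  have := Finset.mem_range.1 hj
  rw [Nat.cast_sub (by omega)]

lemma gen_bound (n m : ℕ) (hm : 1 < m) (hmn : m ≤ n) (s : ℝ) (hs : 0 ≤ s) (N : ℕ) :
    ∑ ℓ ∈ Finset.range N, qq n m ℓ / ((n : ℝ) + s) ^ ℓ ≤
      ∏ j ∈ Finset.range m, (((n : ℝ) - j) / ((n : ℝ) - j + s)) := by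
  obtain ⟨b, rfl⟩ : ∃ b, m = b + 1 := ⟨m - 1, by omega⟩
  have hbn : (b : ℝ) + 1 ≤ n := by exact_mod_cast hmn
  have hb0 : (0 : ℝ) ≤ b := Nat.cast_nonneg b
  have hu0 : 0 < (n : ℝ) + s := by linarith
  set u := (n : ℝ) + s with hu
  have hpos : ∀ j ∈ Finset.range (b + 1), 0 < (n : ℝ) - j := by
    intro j hj
    have : (j : ℝ) ≤ b := by
      have := Finset.mem_range.1 hj
      exact_mod_cast Nat.lt_succ_iff.1 this
    linarith
  cases N with
  | zero =>
    simp only [Finset.range_zero, Finset.sum_empty]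
    apply Finset.prod_nonneg
    intro j hj
    have := hpos j hj
    positivity
  | succ N =>
    have h1 := stir_bound u b (by linarith) N
    rw [Finset.sum_range_succ', qq_zero _ _ 0 (by omega), zero_div, add_zero,
      Finset.prod_div_distrib, ← desc_real n (b+1) hmn]
    have h2 : ∏ j ∈ Finset.range (b + 1), ((n : ℝ) - j + s) =
        (∏ j ∈ Finset.range b, (u - ((j : ℝ) + 1))) * u := by
      rw [Finset.prod_range_succ']
      congr 1
      · apply Finset.prod_congr rfl
        intro j _
        push_cast; ring
      · simp [hu]
    calc _ ≤ ∑ a ∈ Finset.range N, ((b+1).factorial * n.choose (b+1) : ℝ) * ((stirling2 a b : ℝ) / u ^ a) / u := by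
          apply Finset.sum_le_sum
          intro a _
          unfold qq
          have : (if b + 1 ≤ a + 1 then (stirling2 (a + 1 - 1) (b + 1 - 1) : ℝ) else 0) ≤ stirling2 a b := by
            split_ifs
            · simp
            · positivity
          calc _ ≤ ((b+1).factorial * n.choose (b+1) : ℝ) * (stirling2 a b : ℝ) / u ^ (a + 1) := by gcongr
            _ = _ := by field_simp; ring
      _ = ((b+1).factorial * n.choose (b+1) : ℝ) * (∑ a ∈ Finset.range N, (stirling2 a b : ℝ) / u ^ a) / u := by
          rw [Finset.mul_sum, Finset.sum_div]
      _ ≤ ((b+1).factorial * n.choose (b+1) : ℝ) * (∏ j ∈ Finset.range b, 1 / (u - ((j : ℝ) + 1))) / u := by gcongr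
      _ = _ := by
          rw [Finset.prod_div_distrib, Finset.prod_const_one, h2]
          field_simp

lemma q_sum_le_one (n m : ℕ) (hm : 1 < m) (hmn : m ≤ n) (N : ℕ) :
    ∑ ℓ ∈ Finset.range N, qq n m ℓ / (n : ℝ) ^ ℓ ≤ 1 := by
  have := gen_bound n m hm hmn 0 le_rfl N
  simp only [add_zero] at this
  refine this.trans_eq ?_
  apply Finset.prod_eq_one
  intro j hj
  have h1 := Finset.mem_range.1 hj
  have : (j : ℝ) < n := by exact_mod_cast (by omega : j < n)
  apply div_self
  linarith

lemma Erecip_le_of (n m : ℕ) (B : ℝ)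
    (h : ∀ N, ∑ ℓ ∈ Finset.range N, qq n m ℓ / (n : ℝ) ^ ℓ / ℓ ≤ B) : Erecip n m ≤ B := by
  unfold Erecip
  rw [← tsum_mul_left]
  apply Real.tsum_le_of_sum_range_le
  · intro ℓ
    split_ifs <;> positivity
  · intro N
    refine le_trans (le_of_eq ?_) (h N)
    apply Finset.sum_congr rfl
    intro ℓ _
    unfold qq
    split_ifs
    · rw [mul_comm (ℓ : ℝ)]
      simp only [div_eq_mul_inv, mul_inv]
      ring
    · simp

lemma Erecip_trunc (n m L : ℕ) (hm : 1 < m) (hmn : m ≤ n) (hL : 0 < L) :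
    Erecip n m ≤ 1 / L + ∑ ℓ ∈ Finset.range L, qq n m ℓ / (n : ℝ) ^ ℓ * (1 / ℓ - 1 / L) := by
  apply Erecip_le_of
  intro N
  have hq : ∀ ℓ, 0 ≤ qq n m ℓ / (n : ℝ) ^ ℓ := fun ℓ => by
    have := qq_nonneg n m ℓ
    positivity
  have h1 := q_sum_le_one n m hm hmn N
  have h2 : ∑ ℓ ∈ Finset.range N, qq n m ℓ / (n : ℝ) ^ ℓ * (1 / ℓ - 1 / L) ≤
      ∑ ℓ ∈ Finset.range L, qq n m ℓ / (n : ℝ) ^ ℓ * (1 / ℓ - 1 / L) := by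
    have key : ∀ K : ℕ, ∑ ℓ ∈ Finset.range N, qq n m ℓ / (n : ℝ) ^ ℓ * (1 / ℓ - 1 / L) ≤
        ∑ ℓ ∈ Finset.range N ∪ Finset.range L, if ℓ < L then qq n m ℓ / (n : ℝ) ^ ℓ * (1 / ℓ - 1 / L) else 0 := by
      intro _
      have hpos : ∀ ℓ : ℕ, ℓ < L → 0 ≤ qq n m ℓ / (n : ℝ) ^ ℓ * (1 / ℓ - 1 / L) := by
        intro ℓ hl
        rcases Nat.eq_zero_or_pos ℓ with rfl | h0
        · rw [qq_zero _ _ _ (by omega)]; simp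
        · apply mul_nonneg (hq ℓ)
          have : (1 : ℝ) / L ≤ 1 / ℓ := by
            apply one_div_le_one_div_of_le
            · exact_mod_cast h0
            · exact_mod_cast hl.le
          linarith
      calc _ ≤ ∑ ℓ ∈ Finset.range N, if ℓ < L then qq n m ℓ / (n : ℝ) ^ ℓ * (1 / ℓ - 1 / L) else 0 := by
            apply Finset.sum_le_sum
            intro ℓ _
            split_ifs with hl
            · exact le_rfl
            · apply mul_nonpos_of_nonneg_of_nonpos (hq ℓ)
              have : (1 : ℝ) / ℓ ≤ 1 / L := by
                apply one_div_le_one_div_of_le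
                · exact_mod_cast hL
                · exact_mod_cast not_lt.1 hl
              linarith
        _ ≤ _ := by
            apply Finset.sum_le_sum_of_subset_of_nonneg Finset.subset_union_left
            intro ℓ _ _
            split_ifs with hl
            · exact hpos ℓ hl
            · exact le_rfl
    refine (key 0).trans (le_of_eq ?_)
    rw [← Finset.sum_filter]
    congr 1
    ext ℓ
    simp only [Finset.mem_filter, Finset.mem_union, Finset.mem_range]
    omega
  have h3 : ∑ ℓ ∈ Finset.range N, qq n m ℓ / (n : ℝ) ^ ℓ / ℓ =
      ∑ ℓ ∈ Finset.range N, qq n m ℓ / (n : ℝ) ^ ℓ * (1 / ℓ - 1 / L) +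
        (∑ ℓ ∈ Finset.range N, qq n m ℓ / (n : ℝ) ^ ℓ) * (1 / L) := by
    rw [Finset.sum_mul, ← Finset.sum_add_distrib]
    apply Finset.sum_congr rfl
    intro ℓ _
    ring
  have h4 : (∑ ℓ ∈ Finset.range N, qq n m ℓ / (n : ℝ) ^ ℓ) * (1 / L) ≤ 1 * (1 / L) := by
    gcongr
  linarith

lemma Erecip_le_inv (n m : ℕ) (hm : 1 < m) (hmn : m ≤ n) : Erecip n m ≤ 1 / m := by
  have := Erecip_trunc n m m hm hmn (by omega)
  rw [Finset.sum_eq_zero, add_zero] at this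
  · exact this
  · intro ℓ hl
    rw [qq_zero _ _ _ (Finset.mem_range.1 hl)]
    simp

def chk (n m : ℕ) : Prop :=
  (1 / ((2*n+2 : ℕ) : ℚ) + ∑ ℓ ∈ Finset.range (2*n+2),
    ((m.factorial * n.choose m : ℚ) * ((if m ≤ ℓ then stirling2 (ℓ - 1) (m - 1) else 0 : ℕ) : ℚ))
      / (n:ℚ)^ℓ * (1 / ℓ - 1 / ((2*n+2 : ℕ) : ℚ))) ≤
  1 / ∑ j ∈ Finset.range (m-1), (n:ℚ)/((n:ℚ)-j) + ((m : ℚ) - 1) * ((n : ℚ) - m) / (2 * (n : ℚ) ^ 2)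

instance (n m : ℕ) : Decidable (chk n m) := by unfold chk; infer_instance

lemma chk_all : ∀ n ∈ Finset.range 11, ∀ m ∈ Finset.range (n + 1), 1 < m → chk n m := by
  decide +kernel

lemma small_case (n m : ℕ) (hm : 1 < m) (hmn : m ≤ n) (hn : n ≤ 10) :
    Erecip n m ≤ 1 / Ewait n (m - 1) + ((m : ℝ) - 1) * ((n : ℝ) - m) / (2 * (n : ℝ) ^ 2) := by
  have h := chk_all n (Finset.mem_range.2 (by omega)) m (Finset.mem_range.2 (by omega)) hm
  refine (Erecip_trunc n m (2*n+2) hm hmn (by omega)).trans ?_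
  unfold chk at h
  have h2 := (Rat.cast_le (K := ℝ)).2 h
  unfold Ewait qq
  push_cast [apply_ite] at h2 ⊢
  exact h2

lemma Ewait_le (m r : ℕ) (hm : 1 < m) :
    Ewait (m + r) (m - 1) ≤ ((m : ℝ) - 1) * (2 * r + 2 + m) / (2 * (r + 2)) := by
  obtain ⟨b, rfl⟩ : ∃ b, m = b + 1 := ⟨m - 1, by omega⟩
  unfold Ewait
  have hs : ∀ b : ℕ, ∑ j ∈ Finset.range b, (1 + (j : ℝ) / (r + 2)) = b + (b : ℝ) * (b - 1) / 2 / (r + 2) := by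
    intro b
    induction b with
    | zero => simp
    | succ b ih =>
      rw [Finset.sum_range_succ, ih]; push_cast; field_simp; ring
  calc _ ≤ ∑ j ∈ Finset.range (b + 1 - 1), (1 + (j : ℝ) / (r + 2)) := by
        apply Finset.sum_le_sum
        intro j hj
        have h1 := Finset.mem_range.1 hj
        have h2 : (j : ℝ) + 1 ≤ b := by exact_mod_cast (by omega : j + 1 ≤ b)
        have h3 : (0 : ℝ) < r + 2 := by positivity
        have h4 : (r : ℝ) + 2 ≤ ((b + 1 + r : ℕ) : ℝ) - j := by push_cast; linarith
        have h5 : ((b + 1 + r : ℕ) : ℝ) / (((b + 1 + r : ℕ) : ℝ) - j) = 1 + j / (((b + 1 + r : ℕ) : ℝ) - j) := by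
          have : ((b + 1 + r : ℕ) : ℝ) - j ≠ 0 := by linarith
          field_simp; ring
        rw [h5]
        gcongr
    _ = _ := by
        rw [Nat.add_sub_cancel, hs]
        push_cast
        field_simp
        ring

lemma Ewait_pos (n m : ℕ) (hm : 1 < m) (hmn : m ≤ n) : 0 < Ewait n (m - 1) := by
  unfold Ewait
  apply Finset.sum_pos
  · intro j hj
    have h1 := Finset.mem_range.1 hj
    have : (j : ℝ) < n := by exact_mod_cast (by omega : j < n)
    have : (0 : ℝ) < n := by exact_mod_cast (by omega : 0 < n)
    apply div_pos <;> linarith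
  · exact ⟨0, Finset.mem_range.2 (by omega)⟩

lemma big_gap (n m : ℕ) (hm : 1 < m) (hmn : m + 2 ≤ n) :
    Erecip n m ≤ 1 / Ewait n (m - 1) + ((m : ℝ) - 1) * ((n : ℝ) - m) / (2 * (n : ℝ) ^ 2) := by
  refine (Erecip_le_inv n m hm (by omega)).trans ?_
  obtain ⟨r, rfl⟩ : ∃ r, n = m + r := ⟨n - m, by omega⟩
  have h1 := Ewait_le m r hm
  have h0 := Ewait_pos (m + r) m hm (by omega)
  have h2 := one_div_le_one_div_of_le h0 h1
  refine le_trans ?_ (add_le_add_left h2 _)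
  obtain ⟨a, rfl⟩ : ∃ a, m = a + 2 := ⟨m - 2, by omega⟩
  obtain ⟨b, rfl⟩ : ∃ b, r = b + 2 := ⟨r - 2, by omega⟩
  push_cast
  rw [one_div_div, div_add_div _ _ (by ring_nf; positivity) (by positivity), div_le_div_iff₀ (by positivity) (by ring_nf; positivity)]
  have ha : (0 : ℝ) ≤ a := Nat.cast_nonneg a
  have hb : (0 : ℝ) ≤ b := Nat.cast_nonneg b
  generalize (a : ℝ) = x at *
  generalize (b : ℝ) = y at *
  rw [← sub_nonneg]
  ring_nf
  positivity

noncomputable def PP (c m : ℕ) (s : ℝ) : ℝ :=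
  ∏ i ∈ Finset.range m, (((c : ℝ) + i) / ((c : ℝ) + i + s))

noncomputable def SS (c m : ℕ) (s : ℝ) : ℝ :=
  ∑ i ∈ Finset.range m, 1 / ((c : ℝ) + i + s)

lemma PP_pos (c m : ℕ) (hc : 0 < c) (s : ℝ) (hs : 0 ≤ s) : 0 < PP c m s := by
  have : (0 : ℝ) < c := by exact_mod_cast hc
  unfold PP
  apply Finset.prod_pos
  intro i _
  positivity

lemma PP_deriv (c m : ℕ) (hc : 0 < c) (s : ℝ) (hs : 0 ≤ s) :
    HasDerivAt (PP c m) (-(PP c m s * SS c m s)) s := by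
  have hc' : (0 : ℝ) < c := by exact_mod_cast hc
  induction m with
  | zero =>
    have : PP c 0 = fun _ => 1 := by funext x; simp [PP]
    rw [this]
    simpa [SS] using hasDerivAt_const s (1 : ℝ)
  | succ m ih =>
    have e : PP c (m + 1) = fun x => PP c m x * (((c : ℝ) + m) / ((c : ℝ) + m + x)) := by
      funext x; simp only [PP, Finset.prod_range_succ]
    have e2 : SS c (m + 1) s = SS c m s + 1 / ((c : ℝ) + m + s) := by
      simp [SS, Finset.sum_range_succ]
    have hne : (c : ℝ) + m + s ≠ 0 := by positivity
    have hd : HasDerivAt (fun x : ℝ => ((c : ℝ) + m) / ((c : ℝ) + m + x))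
        (-((c : ℝ) + m) / ((c : ℝ) + m + s) ^ 2) s := by
      have := (hasDerivAt_const s ((c : ℝ) + m)).fun_div ((hasDerivAt_id' s).const_add ((c : ℝ) + m)) hne
      exact this.congr_deriv (by ring)
    have := ih.fun_mul hd
    rw [e, e2]
    refine this.congr_deriv ?_
    field_simp
    ring

/-- weight -/
noncomputable def WW (c m : ℕ) (n s : ℝ) : ℝ := PP c m s * ((c : ℝ) + s) ^ (c + 2) / (n + s)

lemma WW_anti (c m : ℕ) (hc : 0 < c) (n : ℝ) (hn : 0 < n)
    (h : (c : ℝ) + 2 ≤ ∑ i ∈ Finset.range m, (c : ℝ) / (c + i)) :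
    AntitoneOn (WW c m n) (Set.Ici 0) := by
  have hc' : (0 : ℝ) < c := by exact_mod_cast hc
  have hder : ∀ s : ℝ, 0 ≤ s → HasDerivAt (WW c m n)
      (WW c m n s * (((c : ℝ) + 2) / (c + s) - SS c m s - 1 / (n + s))) s := by
    intro s hs
    have h1 := PP_deriv c m hc s hs
    have h2 : HasDerivAt (fun x : ℝ => ((c : ℝ) + x) ^ (c + 2)) (((c : ℝ) + 2) * (c + s) ^ (c + 1)) s := by
      have := ((hasDerivAt_id' s).const_add (c : ℝ)).fun_pow (c + 2)
      exact this.congr_deriv (by simp)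
    have h3 := (h1.fun_mul h2).fun_div ((hasDerivAt_id' s).const_add n) (by positivity : n + s ≠ 0)
    have h4 : WW c m n = fun x => PP c m x * ((c : ℝ) + x) ^ (c + 2) / (n + x) := by
      funext x; simp [WW]
    rw [h4]
    refine h3.congr_deriv ?_
    field_simp
    ring
  apply antitoneOn_of_deriv_nonpos (convex_Ici 0)
  · intro s hs
    exact (hder s hs).continuousAt.continuousWithinAt
  · intro s hs
    rw [interior_Ici] at hs
    exact (hder s (le_of_lt hs)).differentiableAt.differentiableWithinAt
  · intro s hs
    rw [interior_Ici] at hs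
    have hs : 0 < s := hs
    rw [(hder s hs.le).deriv]
    have hP := PP_pos c m hc s hs.le
    apply mul_nonpos_of_nonneg_of_nonpos
    · unfold WW; positivity
    · have : ((c : ℝ) + 2) / (c + s) ≤ SS c m s := by
        rw [div_le_iff₀ (by positivity)]
        refine h.trans ?_
        unfold SS
        rw [Finset.sum_mul]
        apply Finset.sum_le_sum
        intro i _
        rw [one_div_mul_eq_div, div_le_div_iff₀ (by positivity) (by positivity)]
        have : (0 : ℝ) ≤ i := Nat.cast_nonneg i
        nlinarith
      have : 0 < 1 / (n + s) := by positivity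
      linarith

/-- pointwise inequality -/
lemma pointwise (c m : ℕ) (hc : 0 < c) (n : ℝ) (hn : 0 < n) (hn2 : ∀ i ∈ Finset.range m, (c : ℝ) + i ≤ n)
    (h : (c : ℝ) + 2 ≤ ∑ i ∈ Finset.range m, (c : ℝ) / (c + i)) :
    ∃ D : ℝ, 0 ≤ D ∧ ∀ s : ℝ, 0 ≤ s →
      ((n + 1) * SS c m 1) * (PP c m s / (n + s)) ≤
        PP c m s * SS c m s + D * (c * (s - 1) / (c + s) ^ (c + 2)) := by
  have hc' : (0 : ℝ) < c := by exact_mod_cast hc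
  set g := ∑ i ∈ Finset.range m, (n - (c + i)) / ((c : ℝ) + i + 1) ^ 2 with hg
  have hg0 : 0 ≤ g := by
    apply Finset.sum_nonneg
    intro i hi
    have := hn2 i hi
    apply div_nonneg (by linarith) (by positivity)
  have hW1 : 0 ≤ WW c m n 1 := by
    have hP := PP_pos c m hc 1 zero_le_one
    unfold WW; positivity
  refine ⟨g * WW c m n 1 / c, by positivity, ?_⟩
  intro s hs
  have hP := PP_pos c m hc s hs
  have hf : (n + 1) * SS c m 1 - g * (s - 1) ≤ (n + s) * SS c m s := by
    unfold SS
    rw [hg, Finset.mul_sum, Finset.mul_sum, Finset.sum_mul, ← Finset.sum_sub_distrib]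
    apply Finset.sum_le_sum
    intro i hi
    have := hn2 i hi
    set k := (c : ℝ) + i with hk
    have hk0 : 0 < k := by positivity
    have e : (n + s) * (1 / (k + s)) - ((n + 1) * (1 / (k + 1)) - (n - k) / (k + 1) ^ 2 * (s - 1))
        = (n - k) * (s - 1) ^ 2 / ((k + s) * (k + 1) ^ 2) := by
      field_simp
      ring
    have : 0 ≤ (n - k) * (s - 1) ^ 2 / ((k + s) * (k + 1) ^ 2) := by
      apply div_nonneg
      · apply mul_nonneg (by linarith) (sq_nonneg _)
      · positivity
    linarith
  have hw : (s - 1) * WW c m n s ≤ (s - 1) * WW c m n 1 := by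
    have hanti := WW_anti c m hc n hn h
    rcases le_total s 1 with h1 | h1
    · exact mul_le_mul_of_nonpos_left (hanti hs (Set.mem_Ici.2 zero_le_one) h1) (by linarith)
    · exact mul_le_mul_of_nonneg_left (hanti (Set.mem_Ici.2 zero_le_one) hs h1) (by linarith)
  have hw2 : (s - 1) * (PP c m s / (n + s)) ≤ (s - 1) * WW c m n 1 / (c + s) ^ (c + 2) := by
    rw [le_div_iff₀ (by positivity)]
    refine le_trans (le_of_eq ?_) hw
    unfold WW; ring
  have h5 : ((n + 1) * SS c m 1 - g * (s - 1)) * (PP c m s / (n + s)) ≤ PP c m s * SS c m s := by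
    calc _ ≤ (n + s) * SS c m s * (PP c m s / (n + s)) := by gcongr
      _ = _ := by field_simp
  have h6 := mul_le_mul_of_nonneg_left hw2 hg0
  have h7 : g * WW c m n 1 / c * (c * (s - 1) / (c + s) ^ (c + 2)) = g * ((s - 1) * WW c m n 1 / (c + s) ^ (c + 2)) := by
    field_simp
  rw [h7]
  linarith

lemma main_analytic (c M : ℕ) (hc : 0 < c) (hM : 0 < M)
    (h : (c : ℝ) + 2 ≤ ∑ i ∈ Finset.range (M + 1), (c : ℝ) / (c + i)) :
    Erecip (c + M) (M + 1) ≤ 1 / ((((c + M : ℕ) : ℝ) + 1) * SS c (M + 1) 1) := by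
  have hc' : (0 : ℝ) < c := by exact_mod_cast hc
  set n : ℕ := c + M with hn
  set m := M + 1 with hm
  have hn0 : (0 : ℝ) < n := by rw [hn]; push_cast; positivity
  set A := ((n : ℝ) + 1) * SS c m 1 with hA
  have hS : 0 < SS c m 1 := by
    unfold SS
    apply Finset.sum_pos
    · intro i _; positivity
    · exact ⟨0, Finset.mem_range.2 (by omega)⟩
  have hA0 : 0 < A := by positivity
  obtain ⟨D, hD, hpt⟩ := pointwise c m hc n hn0 (by
    intro i hi
    have := Finset.mem_range.1 hi
    exact_mod_cast (by omega : c + i ≤ n)) h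
  apply Erecip_le_of
  intro N
  -- the two functions
  set F : ℝ → ℝ := fun s => (PP c m s + D * (s / (c + s) ^ (c + 1))) / A with hF
  set B : ℝ → ℝ := fun s => ∑ ℓ ∈ Finset.range N, qq n m ℓ / ((n : ℝ) + s) ^ ℓ / ℓ with hB
  have hFd : ∀ s : ℝ, 0 ≤ s → HasDerivAt F
      (-(PP c m s * SS c m s + D * (c * (s - 1) / (c + s) ^ (c + 2))) / A) s := by
    intro s hs
    have h1 := PP_deriv c m hc s hs
    have h2 : HasDerivAt (fun x : ℝ => x / ((c : ℝ) + x) ^ (c + 1)) (-(c * (s - 1) / (c + s) ^ (c + 2))) s := by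
      have h3 := ((hasDerivAt_id' s).const_add (c : ℝ)).fun_pow (c + 1)
      have h4 := (hasDerivAt_id' s).fun_div h3 (by positivity)
      refine h4.congr_deriv ?_
      simp only [Nat.add_sub_cancel]
      push_cast
      field_simp
      ring
    have h5 := (h1.fun_add (h2.const_mul D)).div_const A
    exact h5.congr_deriv (by ring)
  have hBd : ∀ s : ℝ, 0 ≤ s → HasDerivAt B
      (-((∑ ℓ ∈ Finset.range N, qq n m ℓ / ((n : ℝ) + s) ^ ℓ) / (n + s))) s := by
    intro s hs
    have key : ∀ ℓ ∈ Finset.range N, HasDerivAt (fun x : ℝ => qq n m ℓ / ((n : ℝ) + x) ^ ℓ / ℓ)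
        (-(qq n m ℓ / ((n : ℝ) + s) ^ ℓ / (n + s))) s := by
      intro ℓ _
      rcases Nat.eq_zero_or_pos ℓ with rfl | h0
      · rw [qq_zero _ _ _ (by omega)]
        simpa using hasDerivAt_const s (0 : ℝ)
      · obtain ⟨k, rfl⟩ : ∃ k, ℓ = k + 1 := ⟨ℓ - 1, by omega⟩
        have h3 := ((hasDerivAt_id' s).const_add (n : ℝ)).fun_pow (k + 1)
        have h4 := ((hasDerivAt_const s (qq n m (k + 1))).fun_div h3
          (by positivity)).div_const ((k + 1 : ℕ) : ℝ)
        refine h4.congr_deriv ?_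
        simp only [Nat.add_sub_cancel]
        push_cast
        field_simp
        ring
    have := HasDerivAt.fun_sum key
    refine this.congr_deriv ?_
    rw [Finset.sum_neg_distrib, Finset.sum_div]
  have hgen : ∀ s : ℝ, 0 ≤ s → ∑ ℓ ∈ Finset.range N, qq n m ℓ / ((n : ℝ) + s) ^ ℓ ≤ PP c m s := by
    intro s hs
    refine (gen_bound n m (by omega) (by omega) s hs N).trans_eq ?_
    unfold PP
    rw [← Finset.prod_range_reflect]
    apply Finset.prod_congr rfl
    intro i hi
    have h1 := Finset.mem_range.1 hi
    have : (n : ℝ) - ((m - 1 - i : ℕ) : ℝ) = c + i := by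
      rw [sub_eq_iff_eq_add]
      exact_mod_cast (by omega : n = c + i + (m - 1 - i))
    rw [this]
  have hanti : AntitoneOn (fun s => F s - B s) (Set.Ici 0) := by
    have hd : ∀ s : ℝ, 0 ≤ s → HasDerivAt (fun s => F s - B s) _ s :=
      fun s hs => (hFd s hs).sub (hBd s hs)
    apply antitoneOn_of_deriv_nonpos (convex_Ici 0)
    · intro s hs
      exact (hd s hs).continuousAt.continuousWithinAt
    · intro s hs
      rw [interior_Ici] at hs
      exact (hd s (le_of_lt hs)).differentiableAt.differentiableWithinAt
    · intro s hs
      rw [interior_Ici] at hs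
      have hs : 0 < s := hs
      rw [(hd s hs.le).deriv]
      have h1 := hpt s hs.le
      have h2 : (∑ ℓ ∈ Finset.range N, qq n m ℓ / ((n : ℝ) + s) ^ ℓ) / (n + s) ≤ PP c m s / (n + s) := by
        have := hgen s hs.le
        gcongr
      have h3 : PP c m s / (n + s) ≤ (PP c m s * SS c m s + D * (c * (s - 1) / (c + s) ^ (c + 2))) / A := by
        rw [le_div_iff₀ hA0]
        linarith
      rw [neg_div]
      linarith
  have hlow : ∀ s : ℝ, 0 < s → -((n : ℝ) / s) ≤ F 0 - B 0 := by
    intro s hs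
    have h1 := hanti (Set.mem_Ici.2 le_rfl) (Set.mem_Ici.2 hs.le) hs.le
    have h2 : 0 ≤ F s := by
      have := PP_pos c m hc s hs.le
      simp only [hF]; positivity
    have h3 : B s ≤ n / s * 1 := by
      have h4 := q_sum_le_one n m (by omega) (by omega) N
      have h5 : B s ≤ n / s * ∑ ℓ ∈ Finset.range N, qq n m ℓ / (n : ℝ) ^ ℓ := by
        rw [Finset.mul_sum]
        apply Finset.sum_le_sum
        intro ℓ _
        rcases Nat.eq_zero_or_pos ℓ with rfl | h0
        · rw [qq_zero _ _ _ (by omega)]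
          simp
        · have hq := qq_nonneg n m ℓ
          obtain ⟨k, rfl⟩ : ∃ k, ℓ = k + 1 := ⟨ℓ - 1, by omega⟩
          have e1 : (n : ℝ) ^ k * s ≤ ((n : ℝ) + s) ^ (k + 1) := by
            rw [pow_succ]
            gcongr <;> linarith
          have e2 : (1 : ℝ) ≤ ((k + 1 : ℕ) : ℝ) := by exact_mod_cast (by omega : 1 ≤ k + 1)
          calc _ ≤ qq n m (k + 1) / ((n : ℝ) + s) ^ (k + 1) := div_le_self (by positivity) e2
            _ ≤ qq n m (k + 1) / ((n : ℝ) ^ k * s) := by gcongr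
            _ = _ := by rw [pow_succ]; field_simp
      refine h5.trans ?_
      gcongr
    simp only at h1
    linarith
  have h0 : 0 ≤ F 0 - B 0 := by
    by_contra hneg
    push Not at hneg
    have := hlow (2 * n / (-(F 0 - B 0))) (by apply div_pos <;> linarith)
    have e : (n : ℝ) / (2 * n / (-(F 0 - B 0))) = (-(F 0 - B 0)) / 2 := by
      field_simp
    rw [e] at this
    linarith
  have hF0 : F 0 = 1 / A := by
    have : PP c m 0 = 1 := by
      unfold PP
      apply Finset.prod_eq_one
      intro i _
      rw [add_zero]
      apply div_self
      positivity
    simp [hF, this]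
  have hB0 : B 0 = ∑ ℓ ∈ Finset.range N, qq n m ℓ / (n : ℝ) ^ ℓ / ℓ := by
    simp [hB]
  rw [← hB0]
  linarith

lemma near_case (c M : ℕ) (hc : 0 < c) (hM : 0 < M)
    (h : (c : ℝ) + 2 ≤ ∑ i ∈ Finset.range (M + 1), (c : ℝ) / (c + i)) :
    Erecip (c + M) (M + 1) ≤ 1 / Ewait (c + M) (M + 1 - 1) := by
  refine (main_analytic c M hc hM h).trans ?_
  apply one_div_le_one_div_of_le (Ewait_pos _ _ (by omega) (by omega))
  have hc' : (0 : ℝ) < c := by exact_mod_cast hc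
  unfold Ewait SS
  rw [Nat.add_sub_cancel, ← Finset.sum_range_reflect, Finset.sum_range_succ, mul_add, Finset.mul_sum]
  have h1 : ∑ j ∈ Finset.range M, ((c + M : ℕ) : ℝ) / (((c + M : ℕ) : ℝ) - ((M - 1 - j : ℕ) : ℝ)) ≤
      ∑ i ∈ Finset.range M, (((c + M : ℕ) : ℝ) + 1) * (1 / ((c : ℝ) + i + 1)) := by
    apply Finset.sum_le_sum
    intro j hj
    have h1 := Finset.mem_range.1 hj
    have : ((c + M : ℕ) : ℝ) - ((M - 1 - j : ℕ) : ℝ) = (c : ℝ) + j + 1 := by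
      rw [sub_eq_iff_eq_add]
      exact_mod_cast (by omega : c + M = c + j + 1 + (M - 1 - j))
    rw [this, mul_one_div]
    gcongr
    linarith
  have h2 : 0 ≤ (((c + M : ℕ) : ℝ) + 1) * (1 / ((c : ℝ) + M + 1)) := by positivity
  linarith

/-- For `1 < m ≤ n`, one has `E_m[1/ℓ] ≤ 1/E_{m−1}[ℓ] + (m−1)(n−m)/(2n²)`. -/
theorem Erecip_le_inv_Ewait_add (n m : ℕ) (hm : 1 < m) (hmn : m ≤ n) :
    Erecip n m ≤ 1 / Ewait n (m - 1) + ((m : ℝ) - 1) * ((n : ℝ) - m) / (2 * (n : ℝ) ^ 2) := by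
  by_cases hn : n ≤ 10
  · exact small_case n m hm hmn hn
  by_cases hr : m + 2 ≤ n
  · exact big_gap n m hm hr
  have herr : 0 ≤ ((m : ℝ) - 1) * ((n : ℝ) - m) / (2 * (n : ℝ) ^ 2) := by
    have h1 : (1 : ℝ) ≤ m := by exact_mod_cast hm.le
    have h2 : (m : ℝ) ≤ n := by exact_mod_cast hmn
    apply div_nonneg
    · apply mul_nonneg <;> linarith
    · positivity
  suffices H : Erecip n m ≤ 1 / Ewait n (m - 1) by linarith
  obtain ⟨M, rfl⟩ : ∃ M, m = M + 1 := ⟨m - 1, by omega⟩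
  have hmono : ∀ (c K : ℕ), K ≤ M + 1 → ∑ i ∈ Finset.range K, (c : ℝ) / (c + i) ≤
      ∑ i ∈ Finset.range (M + 1), (c : ℝ) / (c + i) := by
    intro c K hK
    apply Finset.sum_le_sum_of_subset_of_nonneg (Finset.range_mono hK)
    intro i _ _
    positivity
  rcases (by omega : n = 1 + M ∨ n = 2 + M) with rfl | rfl
  · apply near_case 1 M (by omega) (by omega)
    refine le_trans ?_ (hmono 1 11 (by omega))
    norm_num [Finset.sum_range_succ]
  · apply near_case 2 M (by omega) (by omega)
    refine le_trans ?_ (hmono 2 10 (by omega))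
    norm_num [Finset.sum_range_succ]
end

section
/- For every integer n ≥ 2, E_2[1/ℓ] = n(n−1)·(ln(n/(n−1)) − 1/n), where ln is the natural logarithm, and moreover E_2[1/ℓ] < 1/2. -/
theorem stirling2_one (a : ℕ) : stirling2 (a + 1) 1 = 1 := by
  induction a with
  | zero => simp [stirling2]
  | succ a ih => rw [stirling2, ih]; simp [stirling2]

/-- `E_2[1/ℓ] = n(n−1)·(ln(n/(n−1)) − 1/n)`, and moreover `E_2[1/ℓ] < 1/2`. -/
theorem Erecip_two (n : ℕ) (hn : 2 ≤ n) :
    Erecip n 2 = (n : ℝ) * ((n : ℝ) - 1) * (Real.log ((n : ℝ) / ((n : ℝ) - 1)) - 1 / n) ∧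
    Erecip n 2 < 1 / 2 := by
  have hn2 : (2 : ℝ) ≤ n := by exact_mod_cast hn
  have hn0 : (n : ℝ) ≠ 0 := by linarith
  have hn1 : (n : ℝ) - 1 ≠ 0 := by linarith
  obtain ⟨x, hx⟩ : ∃ x : ℝ, x = 1 / n := ⟨_, rfl⟩
  have hx0 : 0 < x := by rw [hx]; positivity
  have hx1 : x < 1 := by
    rw [hx, div_lt_one (by linarith)]; linarith
  have habs : |x| < 1 := by rw [abs_of_pos hx0]; exact hx1
  have h1 : HasSum (fun k : ℕ => x ^ (k + 2) / ((k : ℝ) + 2)) (-Real.log (1 - x) - x) := by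
    have h := (hasSum_nat_add_iff' 1).mpr (Real.hasSum_pow_div_log_of_abs_lt_one habs)
    convert! h using 1
    · funext k
      push_cast
      ring_nf
    · simp
  have h2 : HasSum (fun k : ℕ => x ^ (k + 2) / 2) (x ^ 2 / 2 * (1 - x)⁻¹) := by
    convert! (hasSum_geometric_of_lt_one hx0.le hx1).mul_left (x ^ 2 / 2) using 1
    funext k
    ring
  have hlt : -Real.log (1 - x) - x < x ^ 2 / 2 * (1 - x)⁻¹ := by
    refine hasSum_lt (i := 1) (fun k => ?_) ?_ h1 h2
    · exact div_le_div_of_nonneg_left (by positivity) (by norm_num)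
        (by linarith [Nat.cast_nonneg (α := ℝ) k])
    · exact div_lt_div_of_pos_left (by positivity) (by norm_num) (by norm_num)
  have h3 : HasSum (fun ℓ : ℕ => if 2 ≤ ℓ then (stirling2 (ℓ - 1) (2 - 1) : ℝ) / (ℓ * n ^ ℓ) else 0)
      (-Real.log (1 - x) - x) := by
    rw [← hasSum_nat_add_iff' 2]
    convert! h1 using 1
    · funext k
      have e : k + 2 - 1 = k + 1 := rfl
      rw [if_pos (by omega), e, stirling2_one, hx]
      push_cast
      rw [div_pow, one_pow, div_div, mul_comm]
    · simp [Finset.sum_range_succ]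
  have hc : ((2 : ℕ).factorial * n.choose 2 : ℝ) = n * (n - 1) := by
    rw [Nat.cast_choose_two]; norm_num [Nat.factorial]; ring
  have hE : Erecip n 2 = n * (n - 1) * (-Real.log (1 - x) - x) := by
    rw [Erecip, h3.tsum_eq, hc]
  have hlog : Real.log ((n : ℝ) / ((n : ℝ) - 1)) = -Real.log (1 - x) := by
    rw [← Real.log_inv, hx]
    congr 1
    field_simp
  refine ⟨by rw [hE, hlog, hx], ?_⟩
  rw [hE]
  have hp : (0 : ℝ) < n * (n - 1) := mul_pos (by linarith) (by linarith)
  refine (mul_lt_mul_of_pos_left hlt hp).trans_eq ?_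
  have : 1 - x = (n - 1) / n := by rw [hx]; field_simp
  rw [this, hx]
  field_simp
end

section
/- For all integers n, m, j with 2 ≤ m ≤ n and 1 ≤ j ≤ m−1, one has the strict inequality E_m[τ_j/ℓ] < (j/(n−j))·E_m[1/ℓ]; that is, the covariance of τ_j and 1/ℓ is negative. -/
/-- `prior χ t` is the set `{χ_1, …, χ_{t−1}}` of values occurring strictly before
position `t` in the sequence `χ`. -/
def prior {n ℓ : ℕ} (χ : Fin ℓ → Fin n) (t : Fin ℓ) : Finset (Fin n) :=
  (Finset.univ.filter (fun s => s < t)).image χ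

/-- `tau j χ` is `τ_j(χ)`: the number of indices `t` with
`χ_t ∈ {χ_1, …, χ_{t−1}}` and `|{χ_1, …, χ_{t−1}}| = j`. -/
def tau {n ℓ : ℕ} (j : ℕ) (χ : Fin ℓ → Fin n) : ℕ :=
  (Finset.univ.filter (fun t => χ t ∈ prior χ t ∧ (prior χ t).card = j)).card

/-- `E_m[τ_j/ℓ] := Σ_{ℓ=m}^∞ (1/(ℓ·n^ℓ))·Σ_{χ∈𝒳_m^{(ℓ)}} τ_j(χ)`.  (The terms with
`ℓ < m` vanish since `𝒳_m^{(ℓ)} = ∅` for `ℓ < m`.) -/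
noncomputable def Etau (n m j : ℕ) : ℝ :=
  ∑' ℓ : ℕ, (∑ χ ∈ pathSet n m ℓ, (tau j χ : ℝ)) / (ℓ * n ^ ℓ)

/-- `E_m[1/ℓ] := Σ_{ℓ=m}^∞ |𝒳_m^{(ℓ)}|/(ℓ·n^ℓ)`, the expected reciprocal of the waiting
time until `m` distinct values have appeared in i.i.d. uniform draws from an `n`-element
set.  (The terms with `ℓ < m` vanish since `𝒳_m^{(ℓ)} = ∅` for `ℓ < m`.) -/
noncomputable def ErecipP (n m : ℕ) : ℝ :=
  ∑' ℓ : ℕ, ((pathSet n m ℓ).card : ℝ) / (ℓ * n ^ ℓ)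

def Dc {n ℓ : ℕ} (χ : Fin ℓ → Fin n) : ℕ := (Finset.image χ Finset.univ).card

def Nc (n ℓ k : ℕ) : ℕ := ∑ χ : Fin ℓ → Fin n, if Dc χ = k then 1 else 0

def Tc (n j ℓ k : ℕ) : ℕ := ∑ χ : Fin ℓ → Fin n, if Dc χ = k then tau j χ else 0

lemma sum_snoc {n ℓ : ℕ} (g : (Fin (ℓ+1) → Fin n) → ℕ) :
    ∑ χ, g χ = ∑ ψ : Fin ℓ → Fin n, ∑ x : Fin n, g (Fin.snoc (α := fun _ => Fin n) ψ x) := by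
  rw [← (Fin.snocEquiv (fun _ : Fin (ℓ+1) => Fin n)).sum_comp, Fintype.sum_prod_type_right]
  rfl

lemma image_snoc {n ℓ : ℕ} (ψ : Fin ℓ → Fin n) (x : Fin n) :
    Finset.image (Fin.snoc (α := fun _ => Fin n) ψ x : Fin (ℓ+1) → Fin n) Finset.univ
      = insert x (Finset.image ψ Finset.univ) := by
  ext y
  simp only [Finset.mem_image, Finset.mem_univ, true_and, Finset.mem_insert, Fin.exists_fin_succ',
    Fin.snoc_castSucc, Fin.snoc_last]
  tauto

lemma Dc_snoc {n ℓ : ℕ} (ψ : Fin ℓ → Fin n) (x : Fin n) :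
    Dc (Fin.snoc (α := fun _ => Fin n) ψ x : Fin (ℓ+1) → Fin n)
      = if x ∈ Finset.image ψ Finset.univ then Dc ψ else Dc ψ + 1 := by
  unfold Dc
  rw [image_snoc]
  split_ifs with h
  · rw [Finset.insert_eq_of_mem h]
  · rw [Finset.card_insert_of_notMem h]

lemma prior_castSucc {n ℓ : ℕ} (ψ : Fin ℓ → Fin n) (x : Fin n) (t : Fin ℓ) :
    prior (Fin.snoc (α := fun _ => Fin n) ψ x : Fin (ℓ+1) → Fin n) t.castSucc = prior ψ t := by
  ext y
  simp only [prior, Finset.mem_image, Finset.mem_filter, Finset.mem_univ, true_and,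
    Fin.exists_fin_succ', Fin.snoc_castSucc, Fin.snoc_last, Fin.castSucc_lt_castSucc_iff]
  have : ¬ (Fin.last ℓ < t.castSucc) := not_lt.mpr (Fin.le_last _)
  simp only [this, false_and, or_false]

lemma prior_last {n ℓ : ℕ} (ψ : Fin ℓ → Fin n) (x : Fin n) :
    prior (Fin.snoc (α := fun _ => Fin n) ψ x : Fin (ℓ+1) → Fin n) (Fin.last ℓ)
      = Finset.image ψ Finset.univ := by
  ext y
  simp [prior, Fin.exists_fin_succ', Fin.castSucc_lt_last]

lemma tau_snoc {n ℓ : ℕ} (j : ℕ) (ψ : Fin ℓ → Fin n) (x : Fin n) :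
    tau j (Fin.snoc (α := fun _ => Fin n) ψ x : Fin (ℓ+1) → Fin n)
      = tau j ψ + if x ∈ Finset.image ψ Finset.univ then (if Dc ψ = j then 1 else 0) else 0 := by
  unfold tau
  rw [Finset.card_filter, Fin.sum_univ_castSucc, Finset.card_filter]
  simp only [prior_castSucc, prior_last, Fin.snoc_castSucc, Fin.snoc_last, Dc, ite_and]
  congr!

lemma sum_ite_I {n : ℕ} (I : Finset (Fin n)) (a b : ℕ) :
    (∑ x : Fin n, if x ∈ I then a else b) = I.card * a + (n - I.card) * b := by
  rw [Finset.sum_ite]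
  have h1 : (Finset.univ.filter (fun x => x ∈ I)) = I := by ext; simp
  have h2 : (Finset.univ.filter (fun x => x ∉ I)) = Iᶜ := by ext; simp
  rw [h1, h2]
  simp [Finset.card_compl]

lemma N_succ (n ℓ k : ℕ) :
    Nc n (ℓ+1) (k+1) = (k+1) * Nc n ℓ (k+1) + (n-k) * Nc n ℓ k := by
  unfold Nc
  rw [sum_snoc, Finset.mul_sum, Finset.mul_sum, ← Finset.sum_add_distrib]
  refine Finset.sum_congr rfl fun ψ _ => ?_
  have : ∀ x, (if Dc (Fin.snoc (α := fun _ => Fin n) ψ x : Fin (ℓ+1) → Fin n) = k+1 then 1 else 0)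
      = if x ∈ Finset.image ψ Finset.univ then (if Dc ψ = k+1 then 1 else 0)
        else (if Dc ψ = k then 1 else 0) := by
    intro x; rw [Dc_snoc]; split_ifs <;> omega
  simp only [this]
  rw [sum_ite_I]
  change Dc ψ * _ + (n - Dc ψ) * _ = _
  congr 1 <;> split_ifs with h <;> simp [h]

lemma T_succ (n j ℓ k : ℕ) :
    Tc n j (ℓ+1) (k+1) = (k+1) * Tc n j ℓ (k+1) + (n-k) * Tc n j ℓ k
      + (if k + 1 = j then (k+1) * Nc n ℓ (k+1) else 0) := by
  unfold Tc Nc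
  have e : (if k + 1 = j then (k+1) * (∑ χ : Fin ℓ → Fin n, if Dc χ = k+1 then 1 else 0) else 0)
    = ∑ χ : Fin ℓ → Fin n, (k+1) * (if k+1 = j then if Dc χ = k+1 then 1 else 0 else 0) := by
    split_ifs
    · rw [Finset.mul_sum]
    · simp
  rw [e, sum_snoc, Finset.mul_sum, Finset.mul_sum, ← Finset.sum_add_distrib,
    ← Finset.sum_add_distrib]
  refine Finset.sum_congr rfl fun ψ _ => ?_
  have : ∀ x, (if Dc (Fin.snoc (α := fun _ => Fin n) ψ x : Fin (ℓ+1) → Fin n) = k+1 then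
      tau j (Fin.snoc (α := fun _ => Fin n) ψ x : Fin (ℓ+1) → Fin n) else 0)
      = if x ∈ Finset.image ψ Finset.univ then
          (if Dc ψ = k+1 then tau j ψ + (if k+1 = j then 1 else 0) else 0)
        else (if Dc ψ = k then tau j ψ else 0) := by
    intro x; rw [Dc_snoc, tau_snoc]; split_ifs <;> omega
  simp only [this]
  rw [sum_ite_I]
  change Dc ψ * _ + (n - Dc ψ) * _ = _
  by_cases h : Dc ψ = k+1
  · simp [h]; split_ifs <;> ring
  · by_cases h' : Dc ψ = k <;> simp [h, h']

lemma tau_zero {n : ℕ} (j : ℕ) (χ : Fin 0 → Fin n) : tau j χ = 0 := by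
  simp [tau]

lemma T_zero (n j k : ℕ) : Tc n j 0 k = 0 := by
  simp [Tc, tau_zero]

lemma N_zero (n k : ℕ) : Nc n 0 (k+1) = 0 := by
  simp [Nc, Dc]

lemma N_zero_zero (n : ℕ) : Nc n 0 0 = 1 := by
  simp [Nc, Dc]

lemma T_Dzero (n j ℓ : ℕ) : Tc n j ℓ 0 = 0 := by
  cases ℓ with
  | zero => exact T_zero _ _ _
  | succ ℓ =>
    refine Finset.sum_eq_zero fun χ _ => ?_
    rw [if_neg]
    simp [Dc, Finset.univ_nonempty.ne_empty]

lemma T_lt (n j ℓ : ℕ) : ∀ k, k < j → Tc n j ℓ k = 0 := by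
  induction ℓ with
  | zero => intro k _; exact T_zero _ _ _
  | succ ℓ ih =>
    intro k hk
    cases k with
    | zero => exact T_Dzero _ _ _
    | succ k =>
      rw [T_succ, ih _ hk, ih k (by omega), if_neg (by omega)]
      simp

lemma T_rec (n j ℓ : ℕ) (hj : 1 ≤ j) : ∀ k, j ≤ k →
    Tc n j (ℓ+1) k = j * (Tc n j ℓ k + Nc n ℓ k) := by
  induction ℓ with
  | zero =>
    intro k hk
    obtain ⟨k, rfl⟩ : ∃ k', k = k' + 1 := ⟨k - 1, by omega⟩
    rw [T_succ]; simp [T_zero, N_zero]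
  | succ ℓ ih =>
    intro k hk
    obtain ⟨k, rfl⟩ : ∃ k', k = k' + 1 := ⟨k - 1, by omega⟩
    rcases Nat.eq_or_lt_of_le hk with h | h
    · rw [T_succ n j (ℓ+1), if_pos h.symm, T_lt n j (ℓ+1) k (by omega), h]
      ring
    · conv_rhs => rw [T_succ n j ℓ, if_neg (by omega), N_succ]
      rw [T_succ n j (ℓ+1), if_neg (by omega), ih _ hk, ih k (by omega)]
      ring

lemma N_diag (n k : ℕ) (hk : k ≤ n) : 0 < Nc n k k := by
  induction k with
  | zero => simp [N_zero_zero]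
  | succ k ih =>
    rw [N_succ]
    have := ih (by omega)
    have h2 : 0 < n - k := by omega
    positivity

lemma mem_path {n m ℓ : ℕ} (ψ : Fin ℓ → Fin n) (x : Fin n) :
    (Fin.snoc (α := fun _ => Fin n) ψ x : Fin (ℓ+1) → Fin n) ∈ pathSet n (m+1) (ℓ+1) ↔
      x ∉ Finset.image ψ Finset.univ ∧ Dc ψ = m := by
  have h := Dc_snoc ψ x
  unfold Dc at h
  have h2 : (∀ t s : Fin (ℓ+1), (t : ℕ) < ℓ + 1 - 1 → (s : ℕ) = ℓ + 1 - 1 →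
      (Fin.snoc (α := fun _ => Fin n) ψ x : Fin (ℓ+1) → Fin n) t ≠
      (Fin.snoc (α := fun _ => Fin n) ψ x : Fin (ℓ+1) → Fin n) s) ↔
      x ∉ Finset.image ψ Finset.univ := by
    simp only [Finset.mem_image, Finset.mem_univ, true_and, not_exists]
    constructor
    · intro H t
      simpa using H t.castSucc (Fin.last ℓ) (by simp) (by simp)
    · intro H t s ht hs
      obtain rfl : s = Fin.last ℓ := by ext; simpa using hs
      obtain ⟨t, rfl⟩ : ∃ t', t = Fin.castSucc t' := ⟨⟨t, by simpa using ht⟩, rfl⟩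
      simpa using H t
  unfold pathSet
  rw [Finset.mem_filter, h2, h]
  unfold Dc
  simp only [Finset.mem_univ, true_and]
  constructor
  · rintro ⟨h3, h4⟩
    rw [if_neg h4] at h3
    exact ⟨h4, by omega⟩
  · rintro ⟨h3, h4⟩
    rw [if_neg h3]
    exact ⟨by omega, h3⟩

lemma path_sum {n m ℓ : ℕ} (g : (Fin (ℓ+1) → Fin n) → ℕ) :
    ∑ χ ∈ pathSet n (m+1) (ℓ+1), g χ = ∑ ψ : Fin ℓ → Fin n, ∑ x : Fin n,
      if x ∈ Finset.image ψ Finset.univ then 0 else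
        if Dc ψ = m then g (Fin.snoc (α := fun _ => Fin n) ψ x) else 0 := by
  have : ∑ χ ∈ pathSet n (m+1) (ℓ+1), g χ
      = ∑ χ, if χ ∈ pathSet n (m+1) (ℓ+1) then g χ else 0 := by
    simp
  rw [this, sum_snoc]
  simp only [mem_path]
  refine Finset.sum_congr rfl fun ψ _ => Finset.sum_congr rfl fun x _ => ?_
  split_ifs <;> tauto

lemma path_card (n m ℓ : ℕ) : (pathSet n (m+1) (ℓ+1)).card = (n - m) * Nc n ℓ m := by
  rw [Finset.card_eq_sum_ones, path_sum, Nc, Finset.mul_sum]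
  refine Finset.sum_congr rfl fun ψ _ => ?_
  rw [sum_ite_I]
  change Dc ψ * _ + (n - Dc ψ) * _ = _
  split_ifs with h <;> simp [h]

lemma path_tau (n m j ℓ : ℕ) :
    ∑ χ ∈ pathSet n (m+1) (ℓ+1), tau j χ = (n - m) * Tc n j ℓ m := by
  rw [path_sum, Tc, Finset.mul_sum]
  refine Finset.sum_congr rfl fun ψ _ => ?_
  have : ∀ x : Fin n, (if x ∈ Finset.image ψ Finset.univ then 0 else
        if Dc ψ = m then tau j (Fin.snoc (α := fun _ => Fin n) ψ x : Fin (ℓ+1) → Fin n) else 0)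
      = if x ∈ Finset.image ψ Finset.univ then 0 else if Dc ψ = m then tau j ψ else 0 := by
    intro x; rw [tau_snoc]; split_ifs <;> rfl
  simp only [this]
  rw [sum_ite_I]
  change Dc ψ * _ + (n - Dc ψ) * _ = _
  split_ifs with h <;> simp [h]

lemma path_card_le (n m ℓ : ℕ) : (pathSet n (m+1) (ℓ+1)).card ≤ n * (n-1)^ℓ := by
  rw [Finset.card_eq_sum_ones, path_sum, Finset.sum_comm]
  have : ∀ x : Fin n, (∑ ψ : Fin ℓ → Fin n, if x ∈ Finset.image ψ Finset.univ then 0 else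
      if Dc ψ = m then 1 else 0) ≤ (n-1)^ℓ := by
    intro x
    calc _ ≤ ∑ ψ : Fin ℓ → Fin n,
          if ψ ∈ Fintype.piFinset (fun _ : Fin ℓ => ({x}ᶜ : Finset (Fin n))) then 1 else 0 := by
          refine Finset.sum_le_sum fun ψ _ => ?_
          by_cases h : x ∈ Finset.image ψ Finset.univ
          · simp [h]
          · have hp : ψ ∈ Fintype.piFinset (fun _ : Fin ℓ => ({x}ᶜ : Finset (Fin n))) := by
              simpa using h
            rw [if_neg h, if_pos hp]
            split_ifs <;> simp
      _ = _ := by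
          rw [Finset.sum_ite_mem, Finset.univ_inter, ← Finset.card_eq_sum_ones,
            Fintype.card_piFinset]
          simp [Finset.card_compl]
  calc _ ≤ ∑ x : Fin n, (n-1)^ℓ := Finset.sum_le_sum fun x _ => this x
    _ = _ := by simp

lemma tau_le {n ℓ : ℕ} (j : ℕ) (χ : Fin ℓ → Fin n) : tau j χ ≤ ℓ := by
  unfold tau
  exact (Finset.card_le_univ _).trans (by simp)

theorem Etau_lt (n m j : ℕ) (hm : 2 ≤ m) (hmn : m ≤ n) (hj : 1 ≤ j) (hjm : j ≤ m - 1) :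
    Etau n m j < ((j : ℝ) / ((n : ℝ) - j)) * ErecipP n m := by
  obtain ⟨m, rfl⟩ : ∃ m', m = m' + 1 := ⟨m - 1, by omega⟩
  have hn : (0:ℝ) < n := by exact_mod_cast (by omega : 0 < n)
  have hjn : (0:ℝ) < (n:ℝ) - j := by
    have : (j:ℝ) < n := by exact_mod_cast (by omega : j < n)
    linarith
  have hj0 : (0:ℝ) < j := by exact_mod_cast hj
  set A : ℕ → ℝ := fun ℓ => ∑ χ ∈ pathSet n (m+1) ℓ, (tau j χ : ℝ) with hA
  set C : ℕ → ℝ := fun ℓ => ((pathSet n (m+1) ℓ).card : ℝ) with hC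
  have hA1 : ∀ ℓ, A (ℓ+1) = ((n - m : ℕ) : ℝ) * Tc n j ℓ m := by
    intro ℓ
    have := path_tau n m j ℓ
    simp only [hA]
    exact_mod_cast this
  have hC1 : ∀ ℓ, C (ℓ+1) = ((n - m : ℕ) : ℝ) * Nc n ℓ m := by
    intro ℓ
    have := path_card n m ℓ
    simp only [hC]
    exact_mod_cast this
  have hAn : ∀ ℓ, 0 ≤ A ℓ := fun ℓ => Finset.sum_nonneg fun _ _ => by positivity
  have hCn : ∀ ℓ, 0 ≤ C ℓ := fun ℓ => by simp only [hC]; positivity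
  have hrec : ∀ ℓ, A (ℓ+2) = j * (A (ℓ+1) + C (ℓ+1)) := by
    intro ℓ
    rw [hA1 (ℓ+1), hA1 ℓ, hC1 ℓ, T_rec n j ℓ hj m (by omega)]
    push_cast; ring
  have hA10 : A 1 = 0 := by rw [hA1 0, T_zero]; simp
  have hCpos : 0 < C (m+1) := by
    rw [hC1]
    have h1 := N_diag n m (by omega)
    have h2 : 0 < n - m := by omega
    positivity
  have hAC : ∀ ℓ, A ℓ ≤ ℓ * C ℓ := by
    intro ℓ
    simp only [hA, hC]
    calc _ ≤ ∑ χ ∈ pathSet n (m+1) ℓ, (ℓ:ℝ) :=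
          Finset.sum_le_sum fun χ _ => by exact_mod_cast tau_le j χ
      _ = _ := by simp [mul_comm]
  have hCs : Summable fun ℓ => C ℓ / (n:ℝ)^ℓ := by
    rw [← summable_nat_add_iff 1]
    have hr : ((n-1 : ℕ):ℝ) / n < 1 := by
      rw [div_lt_one hn]; exact_mod_cast (by omega : n - 1 < n)
    refine Summable.of_nonneg_of_le (fun ℓ => by have := hCn (ℓ+1); positivity) (fun ℓ => ?_)
      (summable_geometric_of_lt_one (by positivity) hr)
    have := path_card_le n m ℓ
    have h2 : C (ℓ+1) ≤ n * ((n-1:ℕ):ℝ)^ℓ := by simp only [hC]; exact_mod_cast this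
    rw [div_pow, div_le_div_iff₀ (by positivity) (by positivity)]
    calc _ ≤ (n * ((n-1:ℕ):ℝ)^ℓ) * (n:ℝ)^ℓ := by gcongr
      _ = _ := by ring
  set f : ℕ → ℝ := fun ℓ => A ℓ / (ℓ * (n:ℝ)^ℓ) with hf
  set g : ℕ → ℝ := fun ℓ => C ℓ / (ℓ * (n:ℝ)^ℓ) with hg
  have hfs : Summable f := by
    refine Summable.of_nonneg_of_le (fun ℓ => by have := hAn ℓ; simp only [hf]; positivity)
      (fun ℓ => ?_) hCs
    simp only [hf]
    rcases Nat.eq_zero_or_pos ℓ with rfl | h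
    · simpa using hCn 0
    · have h' : (0:ℝ) < ℓ := by exact_mod_cast h
      rw [div_le_div_iff₀ (by positivity) (by positivity)]
      calc _ ≤ (ℓ * C ℓ) * (n:ℝ)^ℓ := by gcongr; exact hAC ℓ
        _ = _ := by ring
  have hgs : Summable g := by
    refine Summable.of_nonneg_of_le (fun ℓ => by have := hCn ℓ; simp only [hg]; positivity)
      (fun ℓ => ?_) hCs
    simp only [hg]
    rcases Nat.eq_zero_or_pos ℓ with rfl | h
    · simpa using hCn 0
    · have h' : (1:ℝ) ≤ ℓ := by exact_mod_cast h
      have := hCn ℓ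
      gcongr
      exact le_mul_of_one_le_left (by positivity) h'
  have key : ∀ ℓ, f (ℓ+1+1) = (j/n) * ((f (ℓ+1) + g (ℓ+1)) * ((ℓ+1)/(ℓ+2))) := by
    intro ℓ
    simp only [hf, hg]
    rw [show ℓ+1+1 = ℓ+2 from rfl, hrec]
    have : ((ℓ:ℝ)+1) ≠ 0 := by positivity
    have : ((ℓ:ℝ)+2) ≠ 0 := by positivity
    push_cast
    field_simp
    try ring
  have hfn : ∀ ℓ, 0 ≤ f ℓ := fun ℓ => by have := hAn ℓ; simp only [hf]; positivity
  have hgn : ∀ ℓ, 0 ≤ g ℓ := fun ℓ => by have := hCn ℓ; simp only [hg]; positivity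
  have hfrac : ∀ ℓ : ℕ, ((ℓ:ℝ)+1)/(ℓ+2) < 1 := fun ℓ => by
    rw [div_lt_one (by positivity)]; linarith
  have hle : ∀ ℓ, f (ℓ+1) ≤ (j/n) * (f ℓ + g ℓ) := by
    intro ℓ
    cases ℓ with
    | zero => simp [hf, hg, hA10]
    | succ ℓ =>
      rw [key]
      have := hfn (ℓ+1)
      have := hgn (ℓ+1)
      gcongr
      exact mul_le_of_le_one_right (by positivity) (hfrac ℓ).le
  have hlt : f (m+1+1) < (j/n) * (f (m+1) + g (m+1)) := by
    rw [key]
    have := hfn (m+1)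
    have : 0 < g (m+1) := by simp only [hg]; positivity
    gcongr
    exact mul_lt_of_lt_one_right (by positivity) (hfrac m)
  have hfin : ∑' ℓ, f (ℓ+1) < ∑' ℓ, (j/n) * (f ℓ + g ℓ) :=
    Summable.tsum_lt_tsum hle hlt ((summable_nat_add_iff 1).2 hfs) ((hfs.add hgs).mul_left _)
  rw [tsum_mul_left, hfs.tsum_add hgs] at hfin
  have h0 := hfs.tsum_eq_zero_add
  have hf0 : f 0 = 0 := by simp [hf]
  rw [hf0, zero_add] at h0
  rw [← h0] at hfin
  change ∑' ℓ, f ℓ < _ * ∑' ℓ, g ℓ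
  rw [div_mul_eq_mul_div, lt_div_iff₀ hjn]
  rw [div_mul_eq_mul_div, lt_div_iff₀ hn] at hfin
  linarith
end
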